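/- arXiv:1804.10007 — 4 statements merged into one kernel-verified Lean document; each statement's English description precedes it below -/
import Mathlib

section
/- Let λ, λ' ∈ ℂ satisfy λλ' = q²/((1−q²)(q−q⁻¹)). Then in U_q(sl_2) the elements x = EK⁻¹ + λK⁻¹ and y = F + λ'K⁻¹ satisfy the q²-commutator identity xy − q² yx = (q²/(q−q⁻¹))·1. -/
/-- If `K'` is a two-sided inverse of `K` and `K X = c X K`, then `K' X = c⁻¹ X K'`. -/
theorem inv_mul_eq_smul_mul_inv {A : Type*} [Ring A] [Algebra ℂ A] {c : ℂ} (hc : c ≠ 0)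
    {K K' X : A} (hKK' : K * K' = 1) (hK'K : K' * K = 1) (hKX : K * X = c • (X * K)) :
    K' * X = c⁻¹ • (X * K') := by
  have h : X * K' = c • (K' * X) := by
    calc X * K' = K' * (K * X) * K' := by rw [← mul_assoc, hK'K, one_mul]
      _ = c • (K' * X * (K * K')) := by
        rw [hKX, mul_smul_comm, smul_mul_assoc]
        simp only [mul_assoc]
      _ = c • (K' * X) := by rw [hKK', mul_one]
  rw [h, smul_smul, inv_mul_cancel₀ hc, one_smul]

/-- In `U_q(sl₂)` (any ℂ-algebra with generators `E F K K'` satisfying the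
defining relations), if `λλ' = q²/((1-q²)(q-q⁻¹))`, then
`x = EK⁻¹ + λK⁻¹` and `y = F + λ'K⁻¹` satisfy `xy - q²yx = (q²/(q-q⁻¹))·1`. -/
theorem stmt_0 {A : Type*} [Ring A] [Algebra ℂ A] (q : ℂ) (hq : q ≠ 0)
    (hroot : ∀ n : ℕ, n ≠ 0 → q ^ n ≠ 1)
    (E F K K' : A)
    (hKK' : K * K' = 1) (hK'K : K' * K = 1)
    (hKE : K * E = q ^ 2 • (E * K))
    (hKF : K * F = (q ^ 2)⁻¹ • (F * K))
    (hEF : E * F - F * E = (q - q⁻¹)⁻¹ • (K - K'))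
    (lam lam' : ℂ)
    (hll : lam * lam' = q ^ 2 / ((1 - q ^ 2) * (q - q⁻¹))) :
    (E * K' + lam • K') * (F + lam' • K')
      - q ^ 2 • ((F + lam' • K') * (E * K' + lam • K'))
      = (q ^ 2 / (q - q⁻¹)) • (1 : A) := by
  have hq2 : q ^ 2 ≠ 0 := pow_ne_zero 2 hq
  have h1 : 1 - q ^ 2 ≠ 0 := sub_ne_zero.mpr (hroot 2 two_ne_zero).symm
  have hK'E : K' * E = (q ^ 2)⁻¹ • (E * K') := inv_mul_eq_smul_mul_inv hq2 hKK' hK'K hKE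
  have hK'F : K' * F = q ^ 2 • (F * K') := by
    simpa using inv_mul_eq_smul_mul_inv (inv_ne_zero hq2) hKK' hK'K hKF
  have hxy : (E * K' + lam • K') * (F + lam' • K') = q ^ 2 • (E * F * K')
      + lam' • (E * K' * K') + (lam * q ^ 2) • (F * K') + (lam * lam') • (K' * K') := by
    simp only [add_mul, mul_add, smul_mul_assoc, mul_smul_comm, mul_assoc, hK'F]
    module
  have hyx : (F + lam' • K') * (E * K' + lam • K') = F * E * K' + lam • (F * K')
      + (lam' * (q ^ 2)⁻¹) • (E * K' * K') + (lam * lam') • (K' * K') := by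
    have hK'EK' : K' * (E * K') = (q ^ 2)⁻¹ • (E * (K' * K')) := by
      rw [← mul_assoc, hK'E, smul_mul_assoc, mul_assoc]
    simp only [add_mul, mul_add, smul_mul_assoc, mul_smul_comm, mul_assoc, hK'EK']
    module
  have hcomm : E * F * K' = F * E * K' + (q - q⁻¹)⁻¹ • (1 - K' * K') := by
    rw [← sub_eq_iff_eq_add', ← sub_mul, hEF, smul_mul_assoc, sub_mul, hKK']
  have hll' : lam * lam' * (1 - q ^ 2) = q ^ 2 * (q - q⁻¹)⁻¹ := by
    rw [hll, div_mul_eq_mul_div, mul_comm (1 - q ^ 2), mul_div_mul_right _ _ h1, div_eq_mul_inv]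
  rw [hxy, hyx, hcomm, div_eq_mul_inv]
  match_scalars
  · ring
  · ring
  · linear_combination hll'
  · field_simp
    ring
  · ring
end

section
/- Let λ, λ' ∈ ℂ satisfy λλ' = q²/((1−q²)(q−q⁻¹)). Then the subalgebra B of U_q(sl_2) generated by the two elements EK⁻¹ + λK⁻¹ and F + λ'K⁻¹ is a right coideal subalgebra, i.e. Δ(B) ⊆ B ⊗ U_q(sl_2). -/
open TensorProduct

/-- `C` is a right coideal subalgebra w.r.t. the comultiplication `Δ`:
`Δ(C) ⊆ C ⊗ A`, where `C ⊗ A` is the subspace of `A ⊗ A` spanned by `b ⊗ u`, `b ∈ C`. -/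
def IsRCS {A : Type*} [Ring A] [Algebra ℂ A] (Δ : A →ₐ[ℂ] A ⊗[ℂ] A)
    (C : Subalgebra ℂ A) : Prop :=
  ∀ x ∈ C, Δ x ∈ Submodule.span ℂ
    {z : A ⊗[ℂ] A | ∃ b ∈ (C : Set A), ∃ u : A, z = b ⊗ₜ[ℂ] u}

/-- An algebra homomorphism `A → A ⊗ A` maps the subalgebra generated by `s` into
`adjoin s ⊗ A` as soon as it does so on `s`. -/
theorem isRCS_adjoin {A : Type*} [Ring A] [Algebra ℂ A] (Δ : A →ₐ[ℂ] A ⊗[ℂ] A) (s : Set A)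
    (h : ∀ x ∈ s, Δ x ∈
      (Algebra.TensorProduct.map (Algebra.adjoin ℂ s).val (AlgHom.id ℂ A)).range) :
    IsRCS Δ (Algebra.adjoin ℂ s) := by
  intro x hx
  have hle : Algebra.adjoin ℂ s ≤
      (Algebra.TensorProduct.map (Algebra.adjoin ℂ s).val (AlgHom.id ℂ A)).range.comap Δ :=
    Algebra.adjoin_le h
  obtain ⟨t, ht⟩ := hle hx
  change Algebra.TensorProduct.map (Algebra.adjoin ℂ s).val (AlgHom.id ℂ A) t = Δ x at ht
  rw [← ht]
  clear ht
  induction t with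
  | zero => simp
  | tmul b u => exact Submodule.subset_span ⟨b, b.2, u, rfl⟩
  | add y z hy hz => rw [map_add]; exact Submodule.add_mem _ hy hz

/-- In `U_q(sl₂)`, if `λλ' = q²/((1-q²)(q-q⁻¹))`, then the subalgebra `B`
generated by `EK⁻¹ + λK⁻¹` and `F + λ'K⁻¹` is a right coideal subalgebra. -/
theorem stmt_1 {A : Type*} [Ring A] [Algebra ℂ A] (q : ℂ) (hq : q ≠ 0)
    (hroot : ∀ n : ℕ, n ≠ 0 → q ^ n ≠ 1)
    (E F K K' : A)
    (hKK' : K * K' = 1) (hK'K : K' * K = 1)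
    (hKE : K * E = q ^ 2 • (E * K))
    (hKF : K * F = (q ^ 2)⁻¹ • (F * K))
    (hEF : E * F - F * E = (q - q⁻¹)⁻¹ • (K - K'))
    (Δ : A →ₐ[ℂ] A ⊗[ℂ] A)
    (hΔE : Δ E = E ⊗ₜ[ℂ] 1 + K ⊗ₜ[ℂ] E)
    (hΔF : Δ F = F ⊗ₜ[ℂ] K' + 1 ⊗ₜ[ℂ] F)
    (hΔK : Δ K = K ⊗ₜ[ℂ] K) (hΔK' : Δ K' = K' ⊗ₜ[ℂ] K')
    (lam lam' : ℂ)
    (hll : lam * lam' = q ^ 2 / ((1 - q ^ 2) * (q - q⁻¹))) :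
    IsRCS Δ (Algebra.adjoin ℂ {E * K' + lam • K', F + lam' • K'}) := by
  apply isRCS_adjoin
  have hX : E * K' + lam • K' ∈ Algebra.adjoin ℂ {E * K' + lam • K', F + lam' • K'} :=
    Algebra.subset_adjoin (by simp)
  have hY : F + lam' • K' ∈ Algebra.adjoin ℂ {E * K' + lam • K', F + lam' • K'} :=
    Algebra.subset_adjoin (by simp)
  rintro x (rfl | rfl)
  · refine ⟨⟨_, hX⟩ ⊗ₜ K' + 1 ⊗ₜ (E * K'), ?_⟩
    simp [hΔE, hΔK', add_mul, add_tmul, smul_tmul', hKK']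
    abel
  · refine ⟨⟨_, hY⟩ ⊗ₜ K' + 1 ⊗ₜ F, ?_⟩
    simp [hΔF, hΔK', add_tmul, smul_tmul']
    abel
end

section
/- For all c_F, c_K ∈ ℂ, the subalgebra of U_q(sl_2) generated by the single element EK⁻¹ + c_F·F + c_K·K⁻¹ is a right coideal subalgebra of U_q(sl_2). -/
open TensorProduct

/-- A subalgebra generated by a set whose image under `Δ` lies in `C ⊗ A` is a right coideal
subalgebra. -/
theorem IsRCS.adjoin {A : Type*} [Ring A] [Algebra ℂ A] {Δ : A →ₐ[ℂ] A ⊗[ℂ] A} {s : Set A}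
    (h : ∀ x ∈ s, Δ x ∈ Submodule.span ℂ
      {z : A ⊗[ℂ] A | ∃ b ∈ (Algebra.adjoin ℂ s : Set A), ∃ u : A, z = b ⊗ₜ[ℂ] u}) :
    IsRCS Δ (Algebra.adjoin ℂ s) := by
  have one_mem : (1 : A ⊗[ℂ] A) ∈ Submodule.span ℂ
      {z : A ⊗[ℂ] A | ∃ b ∈ (Algebra.adjoin ℂ s : Set A), ∃ u : A, z = b ⊗ₜ[ℂ] u} :=
    Submodule.subset_span ⟨1, one_mem _, 1, rfl⟩
  intro x hx
  induction hx using Algebra.adjoin_induction with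
  | mem x hx => exact h x hx
  | algebraMap r =>
    rw [AlgHom.commutes, Algebra.algebraMap_eq_smul_one]
    exact Submodule.smul_mem _ _ one_mem
  | add x y _ _ hx hy =>
    rw [map_add]
    exact add_mem hx hy
  | mul x y _ _ hx hy =>
    rw [map_mul]
    have hmul := Submodule.mul_mem_mul hx hy
    rw [Submodule.span_mul_span] at hmul
    refine Submodule.span_mono ?_ hmul
    rintro _ ⟨_, ⟨b, hb, u, rfl⟩, _, ⟨c, hc, v, rfl⟩, rfl⟩
    exact ⟨b * c, mul_mem hb hc, u * v, Algebra.TensorProduct.tmul_mul_tmul b c u v⟩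

/-- For all c_F, c_K ∈ ℂ, the subalgebra of U_q(sl₂) generated by the
single element EK⁻¹ + c_F·F + c_K·K⁻¹ is a right coideal subalgebra. -/
theorem stmt_3 {A : Type*} [Ring A] [Algebra ℂ A] (q : ℂ) (hq : q ≠ 0)
    (hroot : ∀ n : ℕ, n ≠ 0 → q ^ n ≠ 1)
    (E F K K' : A)
    (hKK' : K * K' = 1) (hK'K : K' * K = 1)
    (hKE : K * E = q ^ 2 • (E * K))
    (hKF : K * F = (q ^ 2)⁻¹ • (F * K))
    (hEF : E * F - F * E = (q - q⁻¹)⁻¹ • (K - K'))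
    (Δ : A →ₐ[ℂ] A ⊗[ℂ] A)
    (hΔE : Δ E = E ⊗ₜ[ℂ] 1 + K ⊗ₜ[ℂ] E)
    (hΔF : Δ F = F ⊗ₜ[ℂ] K' + 1 ⊗ₜ[ℂ] F)
    (hΔK : Δ K = K ⊗ₜ[ℂ] K) (hΔK' : Δ K' = K' ⊗ₜ[ℂ] K')
    (cF cK : ℂ) :
    IsRCS Δ (Algebra.adjoin ℂ {E * K' + cF • F + cK • K'}) := by
  refine IsRCS.adjoin fun x hx => ?_
  obtain rfl := Set.mem_singleton_iff.mp hx
  have hΔ : Δ (E * K' + cF • F + cK • K') =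
      (E * K' + cF • F + cK • K') ⊗ₜ[ℂ] K' + 1 ⊗ₜ[ℂ] (E * K' + cF • F) := by
    simp only [map_add, map_mul, map_smul, hΔE, hΔF, hΔK', add_mul,
      Algebra.TensorProduct.tmul_mul_tmul, hKK', one_mul, TensorProduct.add_tmul,
      TensorProduct.tmul_add, TensorProduct.tmul_smul, TensorProduct.smul_tmul', smul_add]
    abel
  rw [hΔ]
  exact add_mem
    (Submodule.subset_span ⟨_, Algebra.subset_adjoin (Set.mem_singleton _), _, rfl⟩)
    (Submodule.subset_span ⟨1, one_mem _, _, rfl⟩)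
end

section
/- Let c ∈ ℂ and let C be a right coideal subalgebra of U_q(sl_3) containing the element E_{αβ} K_{α+β}⁻¹ + c K_{α+β}⁻¹. Then C also contains the element E_α K_α⁻¹. -/
open TensorProduct

/-- Slicing an element of `C ⊗ A` by a functional on the second factor lands in `C`. -/
theorem IsRCS.slice_mem {A : Type*} [Ring A] [Algebra ℂ A] {Δ : A →ₐ[ℂ] A ⊗[ℂ] A}
    {C : Subalgebra ℂ A} (hC : IsRCS Δ C) (f : Module.Dual ℂ A) {x : A} (hx : x ∈ C) :
    TensorProduct.rid ℂ A (f.lTensor A (Δ x)) ∈ C := by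
  have hΔx := hC x hx
  generalize Δ x = y at hΔx ⊢
  induction hΔx using Submodule.span_induction with
  | mem z hz =>
    obtain ⟨b, hb, u, rfl⟩ := hz
    simpa using C.smul_mem hb (f u)
  | zero => simp
  | add y z _ _ hy hz => simpa using C.add_mem hy hz
  | smul r y _ hy => simpa using C.smul_mem hy r

/-- A conjugation eigenvalue relation rewritten as a `q`-commutation relation. -/
theorem mul_eq_smul_mul_of_conj {A : Type*} [Ring A] [Algebra ℂ A] {K K' E : A} {r : ℂ}
    (hK : K' * K = 1) (h : K * E * K' = r • E) : K * E = r • (E * K) := by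
  rw [← smul_mul_assoc, ← h, mul_assoc, hK, mul_one]

/-- Let c ∈ ℂ and let C be a right coideal subalgebra of U_q(sl₃)
containing E_{αβ}K_{α+β}⁻¹ + c K_{α+β}⁻¹.  Then C also contains E_α K_α⁻¹. -/
theorem stmt_15 {A : Type*} [Ring A] [Algebra ℂ A] (q : ℂ) (hq : q ≠ 0)
    (hroot : ∀ n : ℕ, n ≠ 0 → q ^ n ≠ 1)
    (Ea Eb Fa Fb Ka Ka' Kb Kb' : A)
    (hKaKa2 : Ka * Ka' = 1) (hKa2Ka : Ka' * Ka = 1)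
    (hKbKb2 : Kb * Kb' = 1) (hKb2Kb : Kb' * Kb = 1)
    (hKK : Ka * Kb = Kb * Ka)
    (hKaEa : Ka * Ea * Ka' = q ^ 2 • Ea)
    (hKaFa : Ka * Fa * Ka' = (q ^ 2)⁻¹ • Fa)
    (hKbEb : Kb * Eb * Kb' = q ^ 2 • Eb)
    (hKbFb : Kb * Fb * Kb' = (q ^ 2)⁻¹ • Fb)
    (hKaEb : Ka * Eb * Ka' = q⁻¹ • Eb)
    (hKaFb : Ka * Fb * Ka' = q • Fb)
    (hKbEa : Kb * Ea * Kb' = q⁻¹ • Ea)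
    (hKbFa : Kb * Fa * Kb' = q • Fa)
    (hEaFa : Ea * Fa - Fa * Ea = (q - q⁻¹)⁻¹ • (Ka - Ka'))
    (hEbFb : Eb * Fb - Fb * Eb = (q - q⁻¹)⁻¹ • (Kb - Kb'))
    (hEaFb : Ea * Fb - Fb * Ea = 0)
    (hEbFa : Eb * Fa - Fa * Eb = 0)
    (hSerreEa : Ea ^ 2 * Eb - (q + q⁻¹) • (Ea * Eb * Ea) + Eb * Ea ^ 2 = 0)
    (hSerreEb : Eb ^ 2 * Ea - (q + q⁻¹) • (Eb * Ea * Eb) + Ea * Eb ^ 2 = 0)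
    (hSerreFa : Fa ^ 2 * Fb - (q + q⁻¹) • (Fa * Fb * Fa) + Fb * Fa ^ 2 = 0)
    (hSerreFb : Fb ^ 2 * Fa - (q + q⁻¹) • (Fb * Fa * Fb) + Fa * Fb ^ 2 = 0)
    (Δ : A →ₐ[ℂ] A ⊗[ℂ] A)
    (hΔEa : Δ Ea = Ea ⊗ₜ[ℂ] 1 + Ka ⊗ₜ[ℂ] Ea)
    (hΔEb : Δ Eb = Eb ⊗ₜ[ℂ] 1 + Kb ⊗ₜ[ℂ] Eb)
    (hΔFa : Δ Fa = Fa ⊗ₜ[ℂ] Ka' + 1 ⊗ₜ[ℂ] Fa)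
    (hΔFb : Δ Fb = Fb ⊗ₜ[ℂ] Kb' + 1 ⊗ₜ[ℂ] Fb)
    (hΔKa : Δ Ka = Ka ⊗ₜ[ℂ] Ka) (hΔKa2 : Δ Ka' = Ka' ⊗ₜ[ℂ] Ka')
    (hΔKb : Δ Kb = Kb ⊗ₜ[ℂ] Kb) (hΔKb2 : Δ Kb' = Kb' ⊗ₜ[ℂ] Kb')
    (c : ℂ) (C : Subalgebra ℂ A) (hC : IsRCS Δ C)
    (hmem : (Ea * Eb - q⁻¹ • (Eb * Ea)) * (Ka' * Kb') + c • (Ka' * Kb') ∈ C) :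
    Ea * Ka' ∈ C := by
  have hq2 : q ^ 2 ≠ 1 := hroot 2 two_ne_zero
  have hKbEa_comm := mul_eq_smul_mul_of_conj hKb2Kb hKbEa
  have hKaEb_comm := mul_eq_smul_mul_of_conj hKa2Ka hKaEb
  by_cases hEb : Eb = 0
  · have hKb : Kb = Kb' := by
      rw [hEb, zero_mul, mul_zero, sub_zero] at hEbFb
      have hqq : (q - q⁻¹)⁻¹ ≠ 0 := by
        refine inv_ne_zero fun h => hq2 ?_
        field_simp at h
        linear_combination h
      exact sub_eq_zero.1 ((smul_eq_zero.1 hEbFb.symm).resolve_left hqq)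
    have hsq : Kb * Kb = 1 := by nth_rewrite 2 [hKb]; exact hKbKb2
    have hEa : Ea = (q⁻¹ * q⁻¹) • Ea :=
      calc Ea = Kb * (Kb * Ea) := by rw [← mul_assoc, hsq, one_mul]
        _ = (q⁻¹ * q⁻¹) • (Ea * (Kb * Kb)) := by
          rw [hKbEa_comm, mul_smul_comm, ← mul_assoc, hKbEa_comm, smul_mul_assoc, smul_smul,
            mul_assoc]
        _ = (q⁻¹ * q⁻¹) • Ea := by rw [hsq, mul_one]
    have hEa0 : Ea = 0 := by
      have h : (1 - q⁻¹ * q⁻¹) • Ea = 0 := by rw [sub_smul, one_smul, ← hEa, sub_self]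
      refine (smul_eq_zero.1 h).resolve_left fun h => hq2 ?_
      field_simp at h
      linear_combination h
    rw [hEa0, zero_mul]
    exact C.zero_mem
  have hne : Eb * (Ka' * Kb') ≠ 0 := fun h => hEb <|
    calc Eb = Eb * (Ka' * (Kb' * Kb) * Ka) := by rw [hKb2Kb, mul_one, hKa2Ka, mul_one]
      _ = Eb * (Ka' * Kb') * (Kb * Ka) := by simp only [mul_assoc]
      _ = 0 := by rw [h, zero_mul]
  have hinv : Ka * Kb * (Ka' * Kb') = 1 := by
    rw [hKK, mul_assoc, ← mul_assoc Ka, hKaKa2, one_mul, hKbKb2]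
  have hcomm' : Ka' * Kb' = Kb' * Ka' :=
    calc Ka' * Kb' = Kb' * (Ka' * Ka) * Kb * (Ka' * Kb') := by
          rw [hKa2Ka, mul_one, hKb2Kb, one_mul]
      _ = Kb' * Ka' * (Ka * Kb * (Ka' * Kb')) := by simp only [mul_assoc]
      _ = Kb' * Ka' := by rw [hinv, mul_one]
  have hcancel : Ea * Kb * (Ka' * Kb') = Ea * Ka' := by
    rw [hcomm', mul_assoc, ← mul_assoc Kb, hKbKb2, one_mul]
  have hΔE : Δ (Ea * Eb - q⁻¹ • (Eb * Ea)) =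
      (Ea * Eb - q⁻¹ • (Eb * Ea)) ⊗ₜ[ℂ] 1 + (1 - q⁻¹ * q⁻¹) • (Ea * Kb) ⊗ₜ[ℂ] Eb +
        (Ka * Kb) ⊗ₜ[ℂ] (Ea * Eb - q⁻¹ • (Eb * Ea)) := by
    simp only [map_sub, map_smul, map_mul, hΔEa, hΔEb, mul_add, add_mul,
      Algebra.TensorProduct.tmul_mul_tmul, mul_one, one_mul, hKbEa_comm, hKaEb_comm, ← hKK,
      TensorProduct.sub_tmul, TensorProduct.tmul_sub, TensorProduct.tmul_smul,
      ← TensorProduct.smul_tmul']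
    module
  set X := Ea * Eb - q⁻¹ • (Eb * Ea)
  have hΔ : Δ (X * (Ka' * Kb') + c • (Ka' * Kb')) =
      (X * (Ka' * Kb') + c • (Ka' * Kb')) ⊗ₜ[ℂ] (Ka' * Kb') +
        (1 - q⁻¹ * q⁻¹) • (Ea * Ka') ⊗ₜ[ℂ] (Eb * (Ka' * Kb')) +
        1 ⊗ₜ[ℂ] (X * (Ka' * Kb')) := by
    rw [map_add, map_smul, map_mul Δ X, hΔE, map_mul, hΔKa2, hΔKb2]
    simp only [add_mul, Algebra.TensorProduct.tmul_mul_tmul, smul_mul_assoc, hinv, hcancel,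
      one_mul, TensorProduct.add_tmul, ← TensorProduct.smul_tmul']
    abel
  obtain ⟨f, hf⟩ : ∃ f : Module.Dual ℂ A, f (Eb * (Ka' * Kb')) ≠ 0 := by
    by_contra! h
    exact hne ((Module.forall_dual_apply_eq_zero_iff ℂ _).1 h)
  have hslice := hC.slice_mem f hmem
  rw [hΔ] at hslice
  simp only [map_add, map_smul, LinearMap.lTensor_tmul, TensorProduct.rid_tmul] at hslice
  have hs : (1 - q⁻¹ * q⁻¹) * f (Eb * (Ka' * Kb')) ≠ 0 := by
    refine mul_ne_zero (fun h => hq2 ?_) hf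
    field_simp at h
    linear_combination h
  have hmem_smul := C.sub_mem (C.sub_mem hslice (C.smul_mem C.one_mem (f (X * (Ka' * Kb')))))
    (C.smul_mem hmem (f (Ka' * Kb')))
  rw [add_sub_cancel_right, add_sub_cancel_left, smul_smul] at hmem_smul
  simpa only [inv_smul_smul₀ hs] using C.smul_mem hmem_smul ((1 - q⁻¹ * q⁻¹) * f (Eb * (Ka' * Kb')))⁻¹
end
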